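/- Let λ > 0 and 0 < R < l be real numbers. Then ∫₀^R 2πλ u e^{−πλu²} e^{−√(l²−u²)/2} · l/(2√(l²−u²)) du = πλ l e^{−πλl² − 1/(16πλ)} · S(√(l²−R²), l), where S(a,b) = Σ_{n=0}^∞ (πλ)ⁿ/(n!(2n+1)) · ((b − 1/(4πλ))^{2n+1} − (a − 1/(4πλ))^{2n+1}). -/

import Mathlib

open Real MeasureTheory

theorem hasSum_integral_exp_mul_sq (k a b : ℝ) :
    HasSum (fun n : ℕ => k ^ n / ((n.factorial : ℝ) * (2 * n + 1)) *
      (b ^ (2 * n + 1) - a ^ (2 * n + 1))) (∫ x in a..b, Real.exp (k * x ^ 2)) := by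
  have hterm (n : ℕ) : ∫ x in a..b, (k * x ^ 2) ^ n / (n.factorial : ℝ) =
      k ^ n / ((n.factorial : ℝ) * (2 * n + 1)) * (b ^ (2 * n + 1) - a ^ (2 * n + 1)) := by
    simp only [mul_pow, ← pow_mul]
    rw [intervalIntegral.integral_div, intervalIntegral.integral_const_mul, integral_pow]
    push_cast
    field_simp
  simp only [← hterm]
  set M := max |a| |b|
  refine intervalIntegral.hasSum_integral_of_dominated_convergence
    (fun n _ => (|k| * M ^ 2) ^ n / (n.factorial : ℝ)) (fun n => ?_) (fun n => ?_) ?_ ?_ ?_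
  · exact (by fun_prop : Continuous fun x : ℝ =>
      (k * x ^ 2) ^ n / (n.factorial : ℝ)).aestronglyMeasurable
  · refine Filter.Eventually.of_forall fun x hx => ?_
    have hxM : |x| ≤ M := by
      rcases Set.mem_uIoc.1 hx with h | h
      · exact abs_le_max_abs_abs h.1.le h.2
      · exact (abs_le_max_abs_abs h.1.le h.2).trans_eq (max_comm _ _)
    rw [norm_div, norm_pow, norm_mul, norm_pow, Real.norm_natCast, Real.norm_eq_abs,
      Real.norm_eq_abs]
    gcongr
  · exact Filter.Eventually.of_forall fun _ _ => Real.summable_pow_div_factorial _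
  · exact intervalIntegrable_const
  · refine Filter.Eventually.of_forall fun x _ => ?_
    rw [Real.exp_eq_exp_ℝ]
    exact NormedSpace.expSeries_div_hasSum_exp _

theorem stmt_6 (lam R l : ℝ) (hlam : 0 < lam) (hR : 0 < R) (hRl : R < l) :
    ∫ u in (0:ℝ)..R,
        2 * π * lam * u * Real.exp (-(π * lam * u ^ 2)) *
          Real.exp (-(Real.sqrt (l ^ 2 - u ^ 2) / 2)) *
          (l / (2 * Real.sqrt (l ^ 2 - u ^ 2))) =
      π * lam * l * Real.exp (-(π * lam * l ^ 2) - 1 / (16 * π * lam)) *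
        ∑' n : ℕ, (π * lam) ^ n / ((n.factorial : ℝ) * (2 * n + 1)) *
          ((l - 1 / (4 * π * lam)) ^ (2 * n + 1)
            - (Real.sqrt (l ^ 2 - R ^ 2) - 1 / (4 * π * lam)) ^ (2 * n + 1)) := by
  rw [(hasSum_integral_exp_mul_sq _ _ _).tsum_eq]
  set c := 1 / (4 * π * lam) with hc
  set C := π * lam * l * Real.exp (-(π * lam * l ^ 2) - 1 / (16 * π * lam)) with hC
  have hcont : Continuous fun x : ℝ => Real.exp (π * lam * x ^ 2) := by fun_prop
  have hpos : ∀ u ∈ Set.uIcc 0 R, 0 < l ^ 2 - u ^ 2 := by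
    intro u hu
    rw [Set.uIcc_of_le hR.le] at hu
    nlinarith [hu.1, hu.2]
  have hderiv : ∀ u ∈ Set.uIcc 0 R, HasDerivAt
      (fun u => -(C * ∫ x in (0:ℝ)..(Real.sqrt (l ^ 2 - u ^ 2) - c), Real.exp (π * lam * x ^ 2)))
      (2 * π * lam * u * Real.exp (-(π * lam * u ^ 2)) *
          Real.exp (-(Real.sqrt (l ^ 2 - u ^ 2) / 2)) *
          (l / (2 * Real.sqrt (l ^ 2 - u ^ 2)))) u := by
    intro u hu
    have hs := Real.sqrt_pos.2 (hpos u hu)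
    have hsq := Real.sq_sqrt (hpos u hu).le
    have hinner : HasDerivAt (fun u => Real.sqrt (l ^ 2 - u ^ 2) - c)
        (-(2 * u) / (2 * Real.sqrt (l ^ 2 - u ^ 2))) u := by
      have h := (((hasDerivAt_pow 2 u).const_sub (l ^ 2)).sqrt (hpos u hu).ne').sub_const c
      simpa using h
    have hG := hcont.integral_hasStrictDerivAt 0 (Real.sqrt (l ^ 2 - u ^ 2) - c)
    refine (((hG.hasDerivAt.comp u hinner).const_mul C).neg).congr_deriv ?_
    set s := Real.sqrt (l ^ 2 - u ^ 2)
    have hexp : Real.exp (-(π * lam * l ^ 2) - 1 / (16 * π * lam)) *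
        Real.exp (π * lam * (s - c) ^ 2) =
        Real.exp (-(π * lam * u ^ 2)) * Real.exp (-(s / 2)) := by
      rw [← Real.exp_add, ← Real.exp_add, show l ^ 2 = s ^ 2 + u ^ 2 by linarith, hc]
      congr 1
      field_simp
      ring
    calc _ = π * lam * l * (Real.exp (-(π * lam * l ^ 2) - 1 / (16 * π * lam)) *
          Real.exp (π * lam * (s - c) ^ 2)) * (u / s) := by
            rw [hC]
            field_simp
      _ = _ := by
            rw [hexp]
            field_simp
  rw [intervalIntegral.integral_eq_sub_of_hasDerivAt hderiv]
  · have hl : Real.sqrt (l ^ 2 - 0 ^ 2) = l := by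
      rw [zero_pow two_ne_zero, sub_zero, Real.sqrt_sq (hR.trans hRl).le]
    rw [hl, ← intervalIntegral.integral_interval_sub_left (hcont.intervalIntegrable 0 (l - c))
      (hcont.intervalIntegrable 0 (Real.sqrt (l ^ 2 - R ^ 2) - c))]
    ring
  · refine ContinuousOn.intervalIntegrable ?_
    refine ContinuousOn.mul (by fun_prop) (ContinuousOn.div (by fun_prop) (by fun_prop) ?_)
    intro u hu
    exact mul_ne_zero two_ne_zero (Real.sqrt_pos.2 (hpos u hu)).ne'
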